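/- arXiv:2104.11630 — 3 statements merged into one kernel-verified Lean document; each statement's English description precedes it below -/
import Mathlib

section
/- The function f₁(r) = f(r)/r⁴ is absolutely monotonic on (0,1): for every nonnegative integer k and every r ∈ (0,1), the k-th derivative of f₁ at r is nonnegative. -/
open Real Set Filter Topology

/-- The complete elliptic integral of the first kind. -/
noncomputable def K (r : ℝ) : ℝ :=
  ∫ t in (0:ℝ)..(π/2), (1 - r^2 * Real.sin t ^ 2) ^ (-(1:ℝ)/2)

/-- `θ = π(17 - 5π)/32`. -/
noncomputable def θ : ℝ := π * (17 - 5*π) / 32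

noncomputable def f (r : ℝ) : ℝ :=
  (π/2) * (16 - 5 * Real.log (1 - r^2)) - (θ * r^2 + K r) * (16 + (5*π - 16) * r^2)

noncomputable def f₁ (r : ℝ) : ℝ := f r / r^4


lemma pow_bern (s t : ℝ) (hs : 0 ≤ s) (hst : s ≤ t) (e : ℕ) :
    (e : ℝ) * s ^ (e - 1) * (t - s) + s ^ e ≤ t ^ e := by
  induction e with
  | zero => simp
  | succ e ih =>
    have h1 : (e : ℝ) * s ^ (e - 1) * s = e * s ^ e := by
      cases e with
      | zero => simp
      | succ m => simp [pow_succ]; ring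
    have h2 := mul_le_mul_of_nonneg_left ih (hs.trans hst)
    have h3 : 0 ≤ (t - s) * ((e : ℝ) * s ^ (e - 1) * (t - s)) := by
      have : 0 ≤ t - s := sub_nonneg.2 hst
      positivity
    have h4 : t ^ (e + 1) = t * t ^ e := by ring
    have h5 : s ^ (e + 1) = s * s ^ e := by ring
    rw [h4, h5, Nat.add_sub_cancel]
    push_cast
    have h6 : (e : ℝ) * s ^ (e - 1) * s * (t - s) = e * s ^ e * (t - s) := by rw [h1]
    nlinarith

lemma deriv_step (c : ℕ → ℝ) (hc : ∀ n, 0 ≤ c n) (e : ℕ → ℕ) (g : ℝ → ℝ)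
    (hg : ∀ r ∈ Ioo (0:ℝ) 1, HasSum (fun n => c n * r ^ e n) (g r)) :
    ∀ r ∈ Ioo (0:ℝ) 1, HasSum (fun n => (c n * e n) * r ^ (e n - 1)) (deriv g r) := by
  intro r hr
  obtain ⟨s, hs1, hs2⟩ := exists_between hr.2
  obtain ⟨t, ht1, ht2⟩ := exists_between hs2
  have hr0 := hr.1
  have hs0 : 0 < s := hr0.trans hs1
  have ht0 : 0 < t := hs0.trans ht1
  have hts : 0 < t - s := sub_pos.2 ht1
  have hu : Summable (fun n => (t - s)⁻¹ * (c n * t ^ e n)) := (hg t ⟨ht0, ht2⟩).summable.mul_left _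
  have hb : ∀ n y, y ∈ Ioo 0 s → ‖(c n * e n) * y ^ (e n - 1)‖ ≤ (t - s)⁻¹ * (c n * t ^ e n) := by
    intro n y hy
    have hy0 := hy.1
    have hcn := hc n
    rw [Real.norm_of_nonneg (by positivity), inv_mul_eq_div, le_div_iff₀ hts]
    have h1 := pow_bern s t hs0.le ht1.le (e n)
    have h2 : y ^ (e n - 1) ≤ s ^ (e n - 1) := pow_le_pow_left₀ hy0.le hy.2.le _
    have h3 : (e n : ℝ) * y ^ (e n - 1) * (t - s) ≤ e n * s ^ (e n - 1) * (t - s) := by gcongr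
    have h4 : 0 ≤ s ^ e n := by positivity
    calc c n * e n * y ^ (e n - 1) * (t - s) = c n * ((e n : ℝ) * y ^ (e n - 1) * (t - s)) := by ring
      _ ≤ c n * t ^ e n := by gcongr; linarith
  have hd := hasDerivAt_tsum_of_isPreconnected (g := fun n y => c n * y ^ e n)
    (g' := fun n y => (c n * e n) * y ^ (e n - 1)) hu isOpen_Ioo isPreconnected_Ioo
    (by
      intro n y _
      simpa [mul_assoc] using (hasDerivAt_pow (e n) y).const_mul (c n))
    hb (y₀ := r) ⟨hr0, hs1⟩ (hg r hr).summable (y := r) ⟨hr0, hs1⟩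
  have heq : g =ᶠ[𝓝 r] fun z => ∑' n, c n * z ^ e n := by
    filter_upwards [isOpen_Ioo.mem_nhds hr] with z hz
    exact (hg z hz).tsum_eq.symm
  rw [heq.deriv_eq, hd.deriv]
  exact (Summable.of_norm_bounded hu (fun n => hb n r ⟨hr0, hs1⟩)).hasSum

lemma absmono (k : ℕ) : ∀ (c : ℕ → ℝ) (_ : ∀ n, 0 ≤ c n) (e : ℕ → ℕ) (g : ℝ → ℝ)
    (_ : ∀ r ∈ Ioo (0:ℝ) 1, HasSum (fun n => c n * r ^ e n) (g r)),
    ∀ r ∈ Ioo (0:ℝ) 1, 0 ≤ iteratedDeriv k g r := by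
  induction k with
  | zero =>
    intro c hc e g hg r hr
    rw [iteratedDeriv_zero]
    exact (hg r hr).nonneg (fun n => mul_nonneg (hc n) (pow_nonneg hr.1.le _))
  | succ k ih =>
    intro c hc e g hg r hr
    rw [iteratedDeriv_succ']
    exact ih _ (fun n => mul_nonneg (hc n) (Nat.cast_nonneg _)) _ _ (deriv_step c hc e g hg) r hr

noncomputable def vv (n : ℕ) : ℝ := ∏ i ∈ Finset.range n, (2 * (i : ℝ) + 1) / (2 * i + 2)

lemma vv_succ (n : ℕ) : vv (n + 1) = vv n * ((2 * (n : ℝ) + 1) / (2 * n + 2)) := by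
  unfold vv; rw [Finset.prod_range_succ]

lemma vv_zero : vv 0 = 1 := by simp [vv]

lemma vv_pos (n : ℕ) : 0 < vv n := by
  unfold vv; positivity

lemma choose_vv (n : ℕ) : Ring.choose ((1/2 : ℝ) + n - 1) n = vv n := by
  rw [← Ring.multichoose_eq]
  have h := Ring.factorial_nsmul_multichoose_eq_ascPochhammer (1/2 : ℝ) n
  rw [Polynomial.ascPochhammer_smeval_eq_eval] at h
  have h2 : (ascPochhammer ℝ n).eval (1/2) = n.factorial * vv n := by
    clear h
    induction n with
    | zero => simp [vv_zero]
    | succ n ih =>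
      rw [ascPochhammer_succ_eval, ih, vv_succ, Nat.factorial_succ]
      push_cast
      field_simp
      ring
  rw [h2, nsmul_eq_mul] at h
  exact mul_left_cancel₀ (by positivity) h

lemma hasSum_rpow (x : ℝ) (hx0 : 0 ≤ x) (hx : x < 1) :
    HasSum (fun n => vv n * x ^ n) ((1 - x) ^ (-(1:ℝ)/2)) := by
  have h := (Real.one_div_one_sub_rpow_hasFPowerSeriesOnBall_zero (1/2)).hasSum (y := x)
    (by simp [enorm_eq_nnnorm, ← NNReal.coe_lt_coe, abs_of_nonneg hx0, hx])
  rw [zero_add] at h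
  have e1 : (1 - x) ^ (-(1:ℝ)/2) = 1 / (1 - x) ^ ((1:ℝ)/2) := by
    rw [neg_div, Real.rpow_neg (by linarith), one_div ((1 - x) ^ ((1:ℝ)/2))]
  rw [e1]
  refine h.congr_fun ?_
  intro n
  rw [← choose_vv]
  simp [mul_comm]

lemma int_sin (n : ℕ) : ∫ t in (0:ℝ)..(π/2), Real.sin t ^ (2 * n) = π / 2 * vv n := by
  have h : ∫ t in (0:ℝ)..(π/2), Real.sin t ^ (2 * n) = ∫ t in (0:ℝ)..(π/2), Real.cos t ^ (2 * n) := by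
    have := intervalIntegral.integral_comp_sub_left (a := 0) (b := π/2)
      (fun t => Real.sin t ^ (2 * n)) (π/2)
    simp [Real.sin_pi_div_two_sub] at this
    exact this.symm
  rw [h, EulerSine.integral_cos_pow_eq, integral_sin_pow_even, vv]
  ring

lemma hasSum_K (r : ℝ) (hr : r ∈ Ioo (0:ℝ) 1) :
    HasSum (fun n => π / 2 * (vv n ^ 2 * (r ^ 2) ^ n)) (K r) := by
  have hr0 := hr.1
  have hx1 : r ^ 2 < 1 := by nlinarith [hr.1, hr.2]
  have h := intervalIntegral.hasSum_integral_of_dominated_convergence (μ := MeasureTheory.volume)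
    (a := 0) (b := π/2)
    (F := fun n t => vv n * (r ^ 2 * Real.sin t ^ 2) ^ n)
    (f := fun t => (1 - r^2 * Real.sin t ^ 2) ^ (-(1:ℝ)/2))
    (fun n _ => vv n * (r ^ 2) ^ n)
    (by intro n; exact Continuous.aestronglyMeasurable (by fun_prop))
    (by
      intro n
      refine Filter.Eventually.of_forall fun t _ => ?_
      have := (vv_pos n).le
      rw [Real.norm_of_nonneg (by positivity)]
      have h1 : Real.sin t ^ 2 ≤ 1 := Real.sin_sq_le_one t
      gcongr
      nlinarith [sq_nonneg r])
    (Filter.Eventually.of_forall fun t _ => (hasSum_rpow _ (by positivity) hx1).summable)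
    (by simp)
    (by
      refine Filter.Eventually.of_forall fun t _ => hasSum_rpow _ (by positivity) ?_
      have h1 : Real.sin t ^ 2 ≤ 1 := Real.sin_sq_le_one t
      nlinarith [sq_nonneg r])
  unfold K
  refine h.congr_fun ?_
  intro n
  simp_rw [mul_pow, ← pow_mul]
  rw [intervalIntegral.integral_const_mul, intervalIntegral.integral_const_mul, int_sin]
  ring

lemma W_vv (n : ℕ) : Real.Wallis.W n * (vv n ^ 2 * (2 * n + 1)) = 1 := by
  induction n with
  | zero => simp [Real.Wallis.W, vv_zero]
  | succ n ih =>
    rw [Real.Wallis.W_succ, vv_succ]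
    refine Eq.trans ?_ ih
    push_cast
    field_simp
    ring

lemma vv_mono : Monotone (fun n : ℕ => vv n ^ 2 * ((n : ℝ) + 1/4)) := by
  refine monotone_nat_of_le_succ fun n => ?_
  rw [vv_succ, mul_pow, mul_assoc]
  gcongr
  push_cast
  rw [div_pow, div_mul_eq_mul_div, le_div_iff₀ (by positivity)]
  nlinarith [(Nat.cast_nonneg n : (0:ℝ) ≤ n)]

lemma vv_bound (n : ℕ) : vv n ^ 2 * ((n : ℝ) + 1/4) ≤ 1 / π := by
  have hlim : Tendsto (fun m => (2 * Real.Wallis.W m)⁻¹) atTop (𝓝 (2 * (π / 2))⁻¹) := by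
    refine (Real.Wallis.tendsto_W_nhds_pi_div_two.const_mul 2).inv₀ ?_
    positivity
  have h2 : (2 * (π / 2))⁻¹ = 1 / π := by field_simp
  rw [h2] at hlim
  refine ge_of_tendsto hlim ?_
  filter_upwards [eventually_ge_atTop n] with m hm
  refine (vv_mono hm).trans ?_
  have hW := Real.Wallis.W_pos m
  have h3 := W_vv m
  have h4 : (2 * Real.Wallis.W m)⁻¹ = vv m ^ 2 * ((m:ℝ) + 1/2) := by
    refine inv_eq_of_mul_eq_one_right ?_
    linarith
  rw [h4]
  have := vv_pos m
  refine mul_le_mul_of_nonneg_left ?_ (by positivity)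
  linarith

noncomputable def cc (n : ℕ) : ℝ :=
  π / 2 * (5 / ((n:ℝ) + 2) - 16 * vv (n + 2) ^ 2 - (5 * π - 16) * vv (n + 1) ^ 2) +
    if n = 0 then -((5 * π - 16) * θ) else 0

lemma cc_nonneg (n : ℕ) : 0 ≤ cc n := by
  have hp1 := Real.pi_gt_d2
  have hp2 := Real.pi_lt_d2
  unfold cc
  refine add_nonneg (mul_nonneg (by positivity) ?_) ?_
  · have hb := vv_bound (n + 1)
    have hn : (0:ℝ) ≤ n := Nat.cast_nonneg n
    rw [vv_succ (n + 1)]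
    set w := vv (n + 1) ^ 2 with hw
    have hw0 : 0 ≤ w := by positivity
    push_cast at hb ⊢
    rw [le_div_iff₀ Real.pi_pos] at hb
    have e1 : 5 / ((n:ℝ) + 2) - 16 * (vv (n+1) * ((2 * ((n:ℝ) + 1) + 1) / (2 * (n + 1) + 2))) ^ 2
        - (5 * π - 16) * w
        = 5 * (1 - w * (n + 1 + 1/4) * π) / (n + 2)
          + w * (16 * (n + 2) - 4 - 15 / 4 * π * (n + 2)) / (n + 2) ^ 2 := by
      rw [hw]; field_simp; ring
    rw [e1]
    have e2 : 0 ≤ 16 * ((n:ℝ) + 2) - 4 - 15 / 4 * π * (n + 2) := by nlinarith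
    have e3 : 0 ≤ 1 - w * (n + 1 + 1/4) * π := by linarith
    positivity
  · split_ifs
    · have : 0 ≤ θ := by
        unfold θ
        have : 0 ≤ 17 - 5 * π := by linarith
        positivity
      nlinarith
    · exact le_rfl

lemma hasSum_f (r : ℝ) (hr : r ∈ Ioo (0:ℝ) 1) :
    HasSum (fun n => cc n * r ^ (2 * n)) (f₁ r) := by
  have hr0 := hr.1
  have hx1 : r ^ 2 < 1 := by nlinarith [hr.1, hr.2]
  have hK := hasSum_K r hr
  have hL := Real.hasSum_pow_div_log_of_abs_lt_one (x := r ^ 2) (by rwa [abs_of_nonneg (by positivity)])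
  have hS2 := (hasSum_nat_add_iff' 2).2 hK
  have hS1 := ((hasSum_nat_add_iff' 1).2 hK).mul_left (r ^ 2)
  have hL1 := (hasSum_nat_add_iff' 1).2 hL
  have hI : HasSum (fun n : ℕ => if n = 0 then -((5 * π - 16) * θ) * r ^ 4 else 0)
    (-((5 * π - 16) * θ) * r ^ 4) := hasSum_ite_eq 0 _
  have h := (((((hL1.mul_left (5 * (π / 2))).sub (hS2.mul_left 16)).sub
    (hS1.mul_left (5 * π - 16)))).add hI).div_const (r ^ 4)
  refine (congrArg₂ (fun u v => HasSum u v) ?_ ?_).mpr h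
  · funext n
    rw [eq_div_iff (by positivity)]
    unfold cc
    push_cast
    split_ifs with h0
    · subst h0
      norm_num
      ring
    · have : (n:ℝ) + 1 + 1 = n + 2 := by ring
      rw [this]
      field_simp
      ring
  · unfold f₁ f
    congr 1
    simp only [Finset.sum_range_succ, Finset.sum_range_zero, vv_succ, vv_zero, θ]
    push_cast
    ring

theorem f₁_absolutely_monotonic (k : ℕ) (r : ℝ) (hr : r ∈ Ioo (0:ℝ) 1) :
    0 ≤ iteratedDeriv k f₁ r :=
  absmono k cc cc_nonneg (fun n => 2 * n) f₁ hasSum_f r hr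
end

section
/- For every r ∈ (0,1), the function g(r) = [λ r² + K(r)][16 + (5π − 16)r²] − (π/2)[16 − 5 log(1 − r²)] admits the convergent series expansion g(r) = δ r² + ζ r⁴ − Σ_{n=3}^∞ ((5πn² − 16n + 4) Q_n / (2n²)) r^{2n}, where Q_n = 5πn/(5πn² − 16n + 4) − (Γ(n − 1/2)/Γ(n))². -/
open Real Set Filter Topology

/-- The sequence `Q_n`. -/
noncomputable def Q (n : ℕ) : ℝ :=
  5*π*n / (5*π*n^2 - 16*n + 4) - (Real.Gamma ((n:ℝ) - 1/2) / Real.Gamma n)^2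

/-- `lam = 8/5 - log 4`. -/
noncomputable def lam : ℝ := 8/5 - Real.log 4

noncomputable def g (r : ℝ) : ℝ :=
  (lam * r^2 + K r) * (16 + (5*π - 16) * r^2) - (π/2) * (16 - 5 * Real.log (1 - r^2))

noncomputable def g₁ (r : ℝ) : ℝ := g r / r^2

lemma choose_rec (a : ℝ) (n : ℕ) :
    Ring.choose a (n+1) * (n+1) = Ring.choose a n * (a - n) := by
  rw [Ring.choose_eq_smul, Ring.choose_eq_smul, descPochhammer_succ_right,
    Polynomial.smeval_mul, Nat.factorial_succ]
  have h1 : ((n:ℝ)+1) ≠ 0 := by positivity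
  have h2 : (n.factorial:ℝ) ≠ 0 := by positivity
  have h3 : (Polynomial.X - (n : Polynomial ℤ)).smeval a = a - n := by
    rw [Polynomial.smeval_sub]; simp [Polynomial.smeval_X, Polynomial.smeval_natCast]
  rw [h3]
  push_cast
  simp only [smul_eq_mul]
  field_simp

noncomputable def bb (n : ℕ) : ℝ := (-1)^n * Ring.choose (-(1:ℝ)/2) n

lemma bb_zero : bb 0 = 1 := by simp [bb]

lemma bb_succ (n : ℕ) : bb (n+1) = bb n * ((2*n+1)/(2*n+2)) := by
  have h := choose_rec (-(1:ℝ)/2) n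
  have h1 : ((n:ℝ)+1) ≠ 0 := by positivity
  have : Ring.choose (-(1:ℝ)/2) (n+1) = Ring.choose (-(1:ℝ)/2) n * (-(1:ℝ)/2 - n) / (n+1) := by
    rw [eq_div_iff h1, h]
  unfold bb
  rw [this, pow_succ]
  field_simp
  ring

lemma bb_pos (n : ℕ) : 0 < bb n := by
  induction n with
  | zero => simp [bb_zero]
  | succ n ih => rw [bb_succ]; positivity

lemma bb_hasSum (x : ℝ) (hx : |x| < 1) :
    HasSum (fun n : ℕ => bb n * x^n) ((1 - x) ^ (-(1:ℝ)/2)) := by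
  have h := (Real.one_add_rpow_hasFPowerSeriesOnBall_zero (a := -(1:ℝ)/2)).hasSum (y := -x)
    (by simpa [enorm_eq_nnnorm, ← NNReal.coe_lt_coe] using hx)
  simp only [binomialSeries_apply] at h
  have e : (1:ℝ) + (0 + -x) = 1 - x := by ring
  rw [e] at h
  have e2 : (fun n : ℕ => bb n * x^n) =
      fun n : ℕ => Ring.choose (-(1:ℝ)/2) n • (List.ofFn fun _ : Fin n => -x).prod := by
    funext n
    simp only [List.ofFn_const, List.prod_replicate, bb, smul_eq_mul]
    rw [neg_pow x]; ring
  rw [e2]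
  exact h

lemma sin_int (n : ℕ) : ∫ t in (0:ℝ)..(π/2), Real.sin t ^ (2*n) = π/2 * bb n := by
  induction n with
  | zero => simp [bb_zero]
  | succ n ih =>
    rw [show 2*(n+1) = 2*n+2 by ring, integral_sin_pow, ih, bb_succ]
    simp
    ring

lemma gam (n : ℕ) : Real.Gamma ((n:ℝ)+1/2) / Real.Gamma ((n:ℝ)+1) = √π * bb n := by
  induction n with
  | zero => have := Real.Gamma_one_half_eq; simp [bb_zero] at this ⊢; exact this
  | succ n ih =>
    have e : ((n+1:ℕ):ℝ) + 1/2 = ((n:ℝ)+1/2) + 1 := by push_cast; ring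
    have h1 : ((n:ℝ)+1) ≠ 0 := by positivity
    have h2 : ((n:ℝ)+1/2) ≠ 0 := by positivity
    rw [e, Real.Gamma_add_one h2, Real.Gamma_add_one (s := ((n+1:ℕ):ℝ)) (by positivity), bb_succ,
      ← mul_assoc, ← ih]
    push_cast
    have := (Real.Gamma_pos_of_pos (s := (n:ℝ)+1) (by positivity)).ne'
    field_simp

lemma K_hasSum (r : ℝ) (hr : r ∈ Ioo (0:ℝ) 1) :
    HasSum (fun n : ℕ => π/2 * bb n ^ 2 * r^(2*n)) (K r) := by
  have hr2 : |r^2| < 1 := by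
    rw [abs_of_nonneg (sq_nonneg r)]; nlinarith [hr.1, hr.2]
  have key : HasSum (fun n : ℕ => ∫ t in (0:ℝ)..(π/2), bb n * (r^2 * Real.sin t ^ 2)^n)
      (∫ t in (0:ℝ)..(π/2), (1 - r^2 * Real.sin t ^ 2) ^ (-(1:ℝ)/2)) := by
    apply intervalIntegral.hasSum_integral_of_dominated_convergence
      (fun n _ => bb n * (r^2)^n)
    · intro n
      apply Continuous.aestronglyMeasurable
      fun_prop
    · intro n
      refine Eventually.of_forall fun t _ => ?_
      rw [Real.norm_eq_abs, abs_of_nonneg (by have := (bb_pos n).le; positivity)]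
      have := (bb_pos n).le
      gcongr
      nlinarith [Real.sin_sq_le_one t, sq_nonneg r]
    · exact Eventually.of_forall fun t _ => (bb_hasSum _ hr2).summable
    · simp
    · refine Eventually.of_forall fun t _ => bb_hasSum _ ?_
      rw [abs_mul, abs_of_nonneg (sq_nonneg (Real.sin t))]
      nlinarith [Real.sin_sq_le_one t, sq_nonneg r, abs_nonneg (r^2), sq_nonneg (Real.sin t)]
  unfold K
  convert key using 1
  ext n
  have : ∀ t : ℝ, bb n * (r^2 * Real.sin t ^ 2)^n = (bb n * r^(2*n)) * Real.sin t ^ (2*n) := by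
    intro t; rw [mul_pow, ← pow_mul, ← pow_mul]; ring
  simp only [this]
  rw [intervalIntegral.integral_const_mul, sin_int]
  ring

lemma hasSum_tr (a b : ℝ) (f h : ℕ → ℝ) (H : HasSum f a) (e : ∀ n, h n = f n) (e2 : b = a) :
    HasSum h b := by
  rw [funext e, e2]; exact H

theorem g_series (r : ℝ) (hr : r ∈ Ioo (0:ℝ) 1) :
    HasSum (fun n : ℕ =>
        (5*π*((n:ℝ)+3)^2 - 16*((n:ℝ)+3) + 4) * Q (n+3) / (2*((n:ℝ)+3)^2) * r^(2*(n+3)))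
      ((128/5 - 32 * Real.log 2 - 17*π/2 + 5*π^2/2) * r^2 + (-128/5 + 32 * Real.log 2 + (47/8 - 10 * Real.log 2) * π + 5*π^2/8) * r^4 - g r) := by
  have hK := K_hasSum r hr
  have hr2 : |r^2| < 1 := by
    rw [abs_of_nonneg (sq_nonneg r)]; nlinarith [hr.1, hr.2]
  have hL := Real.hasSum_pow_div_log_of_abs_lt_one hr2
  have b0 := bb_zero
  have b1 : bb 1 = 1/2 := by have := bb_succ 0; norm_num [bb_zero] at this; linarith
  have b2 : bb 2 = 3/8 := by have := bb_succ 1; norm_num [b1] at this; linarith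
  have hK3 := (hasSum_nat_add_iff' 3).2 hK
  have hK2 := (hasSum_nat_add_iff' 2).2 hK
  have hL2 := (hasSum_nat_add_iff' 2).2 hL
  have H := ((hL2.mul_left (5*π/2)).sub (hK3.mul_left 16)).sub (hK2.mul_left ((5*π-16)*r^2))
  have l4 : Real.log 4 = 2 * Real.log 2 := by
    rw [show (4:ℝ) = 2^2 by norm_num, Real.log_pow]; norm_num
  refine hasSum_tr _ _ _ _ H ?_ ?_
  · intro n
    have e1 : (((n+3:ℕ):ℝ) - 1/2) = ((n+2:ℕ):ℝ) + 1/2 := by push_cast; ring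
    have e2 : (((n+3:ℕ):ℝ)) = ((n+2:ℕ):ℝ) + 1 := by push_cast; ring
    have hb := bb_succ (n+2)
    have hQ : Q (n+3) = 5*π*((n:ℝ)+3) / (5*π*((n:ℝ)+3)^2 - 16*((n:ℝ)+3) + 4)
        - π * bb (n+2)^2 := by
      unfold Q
      rw [e1, e2, gam, mul_pow, Real.sq_sqrt pi_pos.le]
      push_cast
      ring_nf
    have hD : (5*π*((n:ℝ)+3)^2 - 16*((n:ℝ)+3) + 4) ≠ 0 := by
      have : (3:ℝ) < π := pi_gt_three
      have hn : (0:ℝ) ≤ n := by positivity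
      have : 15*((n:ℝ)+3)^2 ≤ 5*π*((n:ℝ)+3)^2 := by gcongr; linarith
      nlinarith
    have h3 : (n:ℝ)+3 ≠ 0 := by positivity
    rw [hQ, show n+3 = n+2+1 by ring, hb, mul_sub, mul_div_cancel₀ _ hD]
    push_cast
    rw [show ((n:ℝ)+2+1) = n+3 by ring, show (2*((n:ℝ)+2)+2) = 2*(n+3) by ring]
    field_simp
    ring
  · simp only [Finset.sum_range_succ, Finset.sum_range_zero, b0, b1, b2, g, lam, l4]
    norm_num
    ring
end

section
/- The function g₁(r) = g(r)/r² tends to 0 as r tends to 1 from the left within (0,1). -/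
open Real Set Filter Topology

lemma aux_rpow (x : ℝ) (hx : 0 ≤ x) : x ^ (-(1:ℝ)/2) = (√x)⁻¹ := by
  rw [neg_div, Real.rpow_neg hx, Real.sqrt_eq_rpow]

lemma aux_pos (r t : ℝ) (h0 : 0 < r) (h1 : r < 1) : 0 < 1 - r^2 * Real.sin t ^ 2 := by
  have := Real.sin_sq_le_one t
  have h2 : r^2 < 1 := by nlinarith
  nlinarith [sq_nonneg r, sq_nonneg (Real.sin t)]

lemma aux_K (r : ℝ) (h0 : 0 < r) (h1 : r < 1) :
    K r = ∫ t in (0:ℝ)..(π/2), (√(1 - r^2 * Real.sin t ^ 2))⁻¹ := by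
  unfold K
  congr 1
  ext t
  exact aux_rpow _ (aux_pos r t h0 h1).le

lemma aux_cont (r : ℝ) (h0 : 0 < r) (h1 : r < 1) :
    Continuous fun t : ℝ => (√(1 - r^2 * Real.sin t ^ 2))⁻¹ := by
  refine Continuous.inv₀ (by fun_prop) fun t => ?_
  exact (Real.sqrt_pos.2 (aux_pos r t h0 h1)).ne'

lemma aux_J (r : ℝ) (h0 : 0 < r) (h1 : r < 1) :
    ∫ t in (0:ℝ)..(π/2), Real.sin t * (√(1 - r^2 * Real.sin t ^ 2))⁻¹
      = (Real.log (1 + r) - Real.log (1 - r^2) / 2) / r := by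
  have key : ∀ t ∈ uIcc (0:ℝ) (π/2), HasDerivAt
      (fun t => -(1/r) * Real.log (r * Real.cos t + √(1 - r^2 * Real.sin t ^ 2)))
      (Real.sin t * (√(1 - r^2 * Real.sin t ^ 2))⁻¹) t := by
    intro t ht
    rw [uIcc_of_le (by positivity)] at ht
    have hc : 0 ≤ Real.cos t := Real.cos_nonneg_of_mem_Icc ⟨by linarith [ht.1, Real.pi_pos], ht.2⟩
    have hp := aux_pos r t h0 h1
    have hS := Real.sqrt_pos.2 hp
    have d1 : HasDerivAt (fun t => 1 - r^2 * Real.sin t ^ 2)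
        (-(r^2 * (2 * Real.sin t * Real.cos t))) t := by
      have := (((Real.hasDerivAt_sin t).pow 2).const_mul (r^2)).const_sub 1
      refine HasDerivAt.congr_deriv this ?_
      norm_num
    have d2 := ((Real.hasDerivAt_cos t).const_mul r).add (d1.sqrt hp.ne')
    have hpos : 0 < r * Real.cos t + √(1 - r^2 * Real.sin t ^ 2) := by positivity
    have d3 := (d2.log hpos.ne').const_mul (-(1/r))
    refine HasDerivAt.congr_deriv d3 ?_
    simp only [Pi.add_apply]
    generalize √(1 - r^2 * Real.sin t ^ 2) = S at *
    field_simp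
    ring
  rw [intervalIntegral.integral_eq_sub_of_hasDerivAt key
    ((Real.continuous_sin.mul (aux_cont r h0 h1)).intervalIntegrable _ _)]
  simp only [Real.cos_pi_div_two, Real.sin_pi_div_two, Real.cos_zero, Real.sin_zero]
  have h3 : 0 ≤ 1 - r^2 := by nlinarith
  simp only [mul_zero, zero_add, one_pow, mul_one, ne_eq, OfNat.ofNat_ne_zero, not_false_eq_true,
    zero_pow, sub_zero, Real.sqrt_one]
  rw [Real.log_sqrt h3, add_comm r 1]
  field_simp
  ring

lemma aux_log2 : ∫ t in (0:ℝ)..(π/2), Real.cos t / (1 + Real.sin t) = Real.log 2 := by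
  have hs : ∀ t ∈ uIcc (0:ℝ) (π/2), 0 < 1 + Real.sin t := by
    intro t ht
    rw [uIcc_of_le (by positivity)] at ht
    have := Real.sin_nonneg_of_nonneg_of_le_pi ht.1 (by linarith [ht.2, Real.pi_pos])
    linarith
  rw [intervalIntegral.integral_eq_sub_of_hasDerivAt (f := fun t => Real.log (1 + Real.sin t))]
  · norm_num
  · intro t ht
    exact ((Real.hasDerivAt_sin t).const_add 1).log (hs t ht).ne'
  · apply ContinuousOn.intervalIntegrable
    exact ContinuousOn.div (by fun_prop) (by fun_prop) fun t ht => (hs t ht).ne'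

lemma aux_R : Tendsto (fun r : ℝ => ∫ t in (0:ℝ)..(π/2),
    (1 - Real.sin t) * (√(1 - r^2 * Real.sin t ^ 2))⁻¹) (𝓝[Ioo (0:ℝ) 1] 1) (𝓝 (Real.log 2)) := by
  rw [← aux_log2]
  apply intervalIntegral.tendsto_integral_filter_of_dominated_convergence (fun _ => (1:ℝ))
  · filter_upwards [self_mem_nhdsWithin] with r hr
    exact ((continuous_const.sub Real.continuous_sin).mul
      (aux_cont r hr.1 hr.2)).aestronglyMeasurable
  · filter_upwards [self_mem_nhdsWithin] with r hr
    refine Eventually.of_forall fun t ht => ?_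
    rw [uIoc_of_le (by positivity)] at ht
    have h0 := Real.sin_nonneg_of_nonneg_of_le_pi ht.1.le (by linarith [ht.2, Real.pi_pos])
    have h1 := Real.sin_le_one t
    have hp := aux_pos r t hr.1 hr.2
    have hS := Real.sqrt_pos.2 hp
    rw [Real.norm_of_nonneg (by have := inv_pos.2 hS; nlinarith), ← div_eq_mul_inv, div_le_one hS]
    apply Real.le_sqrt_of_sq_le
    have h2 : r^2 ≤ 1 := by nlinarith [hr.1, hr.2]
    nlinarith [sq_nonneg (Real.sin t), mul_le_mul_of_nonneg_right h2 (sq_nonneg (Real.sin t))]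
  · exact intervalIntegrable_const
  · refine Eventually.of_forall fun t ht => ?_
    rw [uIoc_of_le (by positivity)] at ht
    rcases eq_or_lt_of_le ht.2 with h | h
    · subst h
      simp
    · have hc : 0 < Real.cos t :=
        Real.cos_pos_of_mem_Ioo ⟨by linarith [ht.1, Real.pi_pos], h⟩
      have h0 := Real.sin_nonneg_of_nonneg_of_le_pi ht.1.le (by linarith [ht.2, Real.pi_pos])
      have hsc := Real.sin_sq_add_cos_sq t
      have e : 1 - (1:ℝ)^2 * Real.sin t ^ 2 = Real.cos t ^ 2 := by linarith
      have e2 : Real.cos t / (1 + Real.sin t)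
          = (1 - Real.sin t) * (√(1 - (1:ℝ)^2 * Real.sin t ^ 2))⁻¹ := by
        rw [e, Real.sqrt_sq hc.le]
        field_simp
        linarith
      rw [e2]
      have : ContinuousAt (fun r : ℝ => (1 - Real.sin t) * (√(1 - r^2 * Real.sin t ^ 2))⁻¹) 1 := by
        refine ContinuousAt.mul continuousAt_const (ContinuousAt.inv₀ (by fun_prop) ?_)
        rw [e, Real.sqrt_sq hc.le]
        exact hc.ne'
      exact this.tendsto.mono_left nhdsWithin_le_nhds

lemma aux_split (r : ℝ) (h0 : 0 < r) (h1 : r < 1) :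
    K r = (Real.log (1 + r) - Real.log (1 - r^2) / 2) / r + ∫ t in (0:ℝ)..(π/2),
    (1 - Real.sin t) * (√(1 - r^2 * Real.sin t ^ 2))⁻¹ := by
  rw [aux_K r h0 h1, ← aux_J r h0 h1, ← intervalIntegral.integral_add]
  · congr 1
    ext t
    ring
  · exact (Real.continuous_sin.mul (aux_cont r h0 h1)).intervalIntegrable _ _
  · exact ((continuous_const.sub Real.continuous_sin).mul
      (aux_cont r h0 h1)).intervalIntegrable _ _

lemma aux_xlog : Tendsto (fun r : ℝ => (1 - r^2) * Real.log (1 - r^2))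
    (𝓝[Ioo (0:ℝ) 1] 1) (𝓝 0) := by
  have h : ContinuousAt (fun r : ℝ => (1 - r^2) * Real.log (1 - r^2)) 1 :=
    (Real.continuous_mul_log.comp
      (by fun_prop : Continuous fun r : ℝ => 1 - r^2)).continuousAt
  have h2 := h.tendsto.mono_left (nhdsWithin_le_nhds (s := Ioo (0:ℝ) 1))
  simpa using h2

theorem g₁_tendsto_one :
    Tendsto g₁ (𝓝[Ioo (0:ℝ) 1] 1) (𝓝 0) := by
  have hid : Tendsto (fun r : ℝ => r) (𝓝[Ioo (0:ℝ) 1] 1) (𝓝 1) := nhdsWithin_le_nhds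
  have hA : Tendsto (fun r : ℝ => lam * r^2 + Real.log (1 + r) / r) (𝓝[Ioo (0:ℝ) 1] 1)
      (𝓝 (lam * 1^2 + Real.log (1 + 1) / 1)) :=
    ((hid.pow 2).const_mul lam).add (((hid.const_add 1).log (by norm_num)).div hid one_ne_zero)
  have hB : Tendsto (fun r : ℝ => 16 + (5*π - 16) * r^2) (𝓝[Ioo (0:ℝ) 1] 1)
      (𝓝 (16 + (5*π - 16) * 1^2)) := ((hid.pow 2).const_mul _).const_add _
  have hC : Tendsto (fun r : ℝ => ((5*π - 16) * r - 16) / (2 * r * (1 + r)))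
      (𝓝[Ioo (0:ℝ) 1] 1) (𝓝 (((5*π - 16) * 1 - 16) / (2 * 1 * (1 + 1)))) :=
    ((hid.const_mul _).sub_const _).div ((hid.const_mul 2).mul (hid.const_add 1)) (by norm_num)
  have hT := ((((hA.add aux_R).mul hB).sub_const (8*π)).add (aux_xlog.mul hC)).div
    (hid.pow 2) (by norm_num)
  have hl : Real.log 4 = 2 * Real.log 2 := by
    rw [show (4:ℝ) = 2^2 by norm_num, Real.log_pow]; norm_num
  have hz : (((lam * 1^2 + Real.log (1 + 1) / 1 + Real.log 2) * (16 + (5*π - 16) * 1^2) - 8*π)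
      + 0 * (((5*π - 16) * 1 - 16) / (2 * 1 * (1 + 1)))) / (1:ℝ)^2 = 0 := by
    rw [lam, hl, one_add_one_eq_two]
    ring
  rw [hz] at hT
  refine hT.congr' ?_
  filter_upwards [self_mem_nhdsWithin] with r hr
  simp only [Pi.div_apply]
  rw [g₁, g, aux_split r hr.1 hr.2]
  have h0 := hr.1
  have h1 : 0 < 1 + r := by linarith
  generalize (∫ t in (0:ℝ)..(π/2), (1 - Real.sin t) * (√(1 - r^2 * Real.sin t ^ 2))⁻¹) = R
  congr 1
  generalize Real.log (1 - r^2) = L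
  generalize Real.log (1 + r) = M
  field_simp
  ring
end
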